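/- There exists a constant c ≥ 1, depending only on L, such that 𝓡̄_n ≥ c⁻¹·(L²/#A)ⁿ for all n ≥ 0; note that L²/#A > 1 since #A ≤ L² − 1. (A priori exponential lower bound for the side-to-side resistance; Lemma 3.5 of the paper in the planar case.) -/

import Mathlib

open Finset
open scoped Classical

namespace Carpet

/-- The contraction map `Ψ_{(a,b)}(x,y) = ((x+a)/L, (y+b)/L)`. -/
noncomputable def Psi (L : ℕ) (p : ℕ × ℕ) (x : ℝ × ℝ) : ℝ × ℝ :=
  ((x.1 + p.1) / L, (x.2 + p.2) / L)

/-- Words of length `n` over the alphabet `A`. -/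
abbrev Word (A : Finset (ℕ × ℕ)) (n : ℕ) := Fin n → {p : ℕ × ℕ // p ∈ A}

/-- `Ψ_w = Ψ_{w₁} ∘ ⋯ ∘ Ψ_{w_n}`. -/
noncomputable def PsiW (L : ℕ) {A : Finset (ℕ × ℕ)} {n : ℕ} (w : Word A n) : ℝ × ℝ → ℝ × ℝ :=
  (List.ofFn fun i => Psi L (w i).1).foldr (· ∘ ·) id

/-- The four corners of the unit square. -/
noncomputable def V0 : Finset (ℝ × ℝ) :=
  {((0 : ℝ), (0 : ℝ)), ((1 : ℝ), (0 : ℝ)), ((1 : ℝ), (1 : ℝ)), ((0 : ℝ), (1 : ℝ))}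

/-- The level-`n` vertex set `V_n = ⋃_{w ∈ W_n} Ψ_w(V₀)`. -/
noncomputable def VN (L : ℕ) (A : Finset (ℕ × ℕ)) (n : ℕ) : Finset (ℝ × ℝ) :=
  (Finset.univ : Finset (Word A n)).biUnion fun w => V0.image (PsiW L w)

/-- Euclidean distance in the plane. -/
noncomputable def eudist (x y : ℝ × ℝ) : ℝ :=
  Real.sqrt ((x.1 - y.1) ^ 2 + (x.2 - y.2) ^ 2)

/-- `n`-adjacency: `x = Ψ_w(p)`, `y = Ψ_w(q)` with `p, q ∈ V₀`, `|p - q| = 1`. -/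
def Adj (L : ℕ) (A : Finset (ℕ × ℕ)) (n : ℕ) (x y : ℝ × ℝ) : Prop :=
  ∃ w : Word A n, ∃ p ∈ V0, ∃ q ∈ V0,
    eudist p q = 1 ∧ x = PsiW L w p ∧ y = PsiW L w q

/-- The natural graph energy `D_n(f) = Σ_{x ∼ y} (f x - f y)²`
(summing over ordered pairs and halving). -/
noncomputable def Dform (L : ℕ) (A : Finset (ℕ × ℕ)) (n : ℕ) (f : ℝ × ℝ → ℝ) : ℝ :=
  (1 / 2) * ∑ x ∈ VN L A n, ∑ y ∈ VN L A n,
    (if Adj L A n x y then (f x - f y) ^ 2 else 0)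

/-- The effective resistance between `S` and `T` in the level-`n` graph. -/
noncomputable def EffRes (L : ℕ) (A : Finset (ℕ × ℕ)) (n : ℕ) (S T : Set (ℝ × ℝ)) : ℝ :=
  (sInf {e : ℝ | ∃ f : ℝ × ℝ → ℝ,
      (∀ x ∈ S, f x = 1) ∧ (∀ x ∈ T, f x = 0) ∧ e = Dform L A n f})⁻¹

/-- `𝓡_n`, the resistance between the corners `(0,0)` and `(1,0)`. -/
noncomputable def RR (L : ℕ) (A : Finset (ℕ × ℕ)) (n : ℕ) : ℝ :=
  EffRes L A n {((0 : ℝ), (0 : ℝ))} {((1 : ℝ), (0 : ℝ))}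

/-- `𝓡̄_n`, the resistance between the left and right sides of the unit square. -/
noncomputable def RRbar (L : ℕ) (A : Finset (ℕ × ℕ)) (n : ℕ) : ℝ :=
  EffRes L A n
    ((VN L A n : Set (ℝ × ℝ)) ∩ ({(0 : ℝ)} ×ˢ Set.Icc (0 : ℝ) 1))
    ((VN L A n : Set (ℝ × ℝ)) ∩ ({(1 : ℝ)} ×ˢ Set.Icc (0 : ℝ) 1))

/-- The standing assumptions on `(L, A)` defining a generalized Sierpiński carpet. -/
structure GoodCarpet (L : ℕ) (A : Finset (ℕ × ℕ)) : Prop where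
  three_le : 3 ≤ L
  mem_lt : ∀ p ∈ A, p.1 < L ∧ p.2 < L
  symm_swap : ∀ a b : ℕ, (a, b) ∈ A → (b, a) ∈ A
  symm_reflect : ∀ a b : ℕ, (a, b) ∈ A → (L - 1 - a, b) ∈ A
  connected : IsConnected
    (⋃ p ∈ A, Set.Icc (((p.1 : ℝ) / L, (p.2 : ℝ) / L) : ℝ × ℝ)
      ((((p.1 : ℝ) + 1) / L, ((p.2 : ℝ) + 1) / L) : ℝ × ℝ))
  flat_border : ∀ a b : ℕ, a < L → b < L →
    (a = 0 ∨ a = L - 1 ∨ b = 0 ∨ b = L - 1) → (a, b) ∈ A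
  proper : ∃ a b : ℕ, a < L ∧ b < L ∧ (a, b) ∉ A

/-- The generalized Sierpiński carpet `F`. -/
def carpetF (L : ℕ) (A : Finset (ℕ × ℕ)) : Set (ℝ × ℝ) :=
  ⋂ n : ℕ, ⋃ w : Word A n, PsiW L w '' Set.Icc (((0 : ℝ), (0 : ℝ)) : ℝ × ℝ) ((1 : ℝ), (1 : ℝ))


theorem PsiW_succ (L : ℕ) {A : Finset (ℕ × ℕ)} {n : ℕ} (w : Word A (n + 1)) (x : ℝ × ℝ) :
    PsiW L w x = Psi L (w 0).1 (PsiW L (fun i : Fin n => w i.succ) x) := by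
  simp [PsiW, List.ofFn_succ]

theorem PsiW_form (L : ℕ) {A : Finset (ℕ × ℕ)} (hL : 0 < L) : ∀ {n : ℕ} (w : Word A n),
    ∃ s : ℝ, ∀ x : ℝ × ℝ, (PsiW L w x).1 = (x.1 + s) / (L : ℝ) ^ n := by
  intro n
  induction n with
  | zero => intro w; exact ⟨0, fun x => by simp [PsiW]⟩
  | succ n ih =>
    intro w
    obtain ⟨s, hs⟩ := ih (fun i : Fin n => w i.succ)
    refine ⟨s + (w 0).1.1 * (L : ℝ) ^ n, fun x => ?_⟩
    have hL' : (L : ℝ) ≠ 0 := by positivity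
    rw [PsiW_succ]
    simp only [Psi, hs]
    field_simp
    ring

theorem bottom_word (L : ℕ) (A : Finset (ℕ × ℕ)) (h : GoodCarpet L A) (n : ℕ) :
    ∀ k : ℕ, k < L ^ n → ∃ w : Word A n, ∀ t : ℝ,
      PsiW L w (t, 0) = ((t + k) / (L : ℝ) ^ n, 0) := by
  have hL0 : 0 < L := by have := h.three_le; omega
  have hL' : (L : ℝ) ≠ 0 := by positivity
  induction n with
  | zero =>
    intro k hk
    have : k = 0 := by simpa using hk
    subst this
    exact ⟨fun i => i.elim0, fun t => by simp [PsiW]⟩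
  | succ n ih =>
    intro k hk
    obtain ⟨w, hw⟩ := ih (k % L ^ n) (Nat.mod_lt _ (by positivity))
    have hd : k / L ^ n < L := by
      apply Nat.div_lt_of_lt_mul
      rwa [← pow_succ]
    have hmem : (k / L ^ n, 0) ∈ A := h.flat_border _ _ hd hL0 (by simp)
    refine ⟨Fin.cons ⟨(k / L ^ n, 0), hmem⟩ w, fun t => ?_⟩
    rw [PsiW_succ]
    simp only [Fin.cons_zero, Fin.cons_succ]
    rw [hw]
    have hk : (k : ℝ) = ((k % L ^ n : ℕ) : ℝ) + (L : ℝ) ^ n * ((k / L ^ n : ℕ) : ℝ) := by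
      exact_mod_cast (Nat.mod_add_div k (L ^ n)).symm
    simp only [Psi, Prod.mk.injEq]
    constructor
    · generalize ((k % L ^ n : ℕ) : ℝ) = u at *
      generalize ((k / L ^ n : ℕ) : ℝ) = v at *
      rw [hk]
      field_simp
      ring
    · simp

theorem Dform_nonneg (L : ℕ) (A : Finset (ℕ × ℕ)) (n : ℕ) (f : ℝ × ℝ → ℝ) :
    0 ≤ Dform L A n f := by
  unfold Dform
  refine mul_nonneg (by norm_num) (Finset.sum_nonneg fun x _ => Finset.sum_nonneg fun y _ => ?_)
  split_ifs <;> positivity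

theorem mem_VN_of (L : ℕ) (A : Finset (ℕ × ℕ)) (n : ℕ) (w : Word A n) (p : ℝ × ℝ) (hp : p ∈ V0) :
    PsiW L w p ∈ VN L A n := by
  unfold VN
  exact Finset.mem_biUnion.2 ⟨w, Finset.mem_univ _, Finset.mem_image_of_mem _ hp⟩

theorem edge_le (L : ℕ) (A : Finset (ℕ × ℕ)) (n : ℕ) (f : ℝ × ℝ → ℝ) (x y : ℝ × ℝ)
    (hx : x ∈ VN L A n) (hy : y ∈ VN L A n) (hxy : Adj L A n x y) :
    (f x - f y) ^ 2 ≤ 2 * Dform L A n f := by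
  have hn : ∀ x y : ℝ × ℝ, 0 ≤ (if Adj L A n x y then (f x - f y) ^ 2 else 0) := by
    intro x y
    split_ifs <;> positivity
  have h1 := Finset.single_le_sum
    (f := fun y => if Adj L A n x y then (f x - f y) ^ 2 else 0) (fun y _ => hn x y) hy
  have h2 := Finset.single_le_sum
    (f := fun x => ∑ y ∈ VN L A n, if Adj L A n x y then (f x - f y) ^ 2 else 0)
    (fun x _ => Finset.sum_nonneg fun y _ => hn x y) hx
  simp only [hxy, if_true] at h1 h2
  unfold Dform
  linarith

theorem Dform_lower (L : ℕ) (A : Finset (ℕ × ℕ)) (h : GoodCarpet L A) (n : ℕ) (f : ℝ × ℝ → ℝ)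
    (h1 : ∀ x ∈ (VN L A n : Set (ℝ × ℝ)) ∩ ({(0 : ℝ)} ×ˢ Set.Icc (0 : ℝ) 1), f x = 1)
    (h0 : ∀ x ∈ (VN L A n : Set (ℝ × ℝ)) ∩ ({(1 : ℝ)} ×ˢ Set.Icc (0 : ℝ) 1), f x = 0) :
    (2 * ((L : ℝ) ^ n) ^ 2)⁻¹ ≤ Dform L A n f := by
  have hL0 : 0 < L := by have := h.three_le; omega
  have hL' : (0 : ℝ) < (L : ℝ) ^ n := by positivity
  have hN : 0 < L ^ n := by positivity
  have v0 : ((0 : ℝ), (0 : ℝ)) ∈ V0 := by simp [V0]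
  have v1 : ((1 : ℝ), (0 : ℝ)) ∈ V0 := by simp [V0]
  set g : ℕ → ℝ := fun k => f ((k : ℝ) / (L : ℝ) ^ n, 0) with hg
  have hstep : ∀ k < L ^ n, |g k - g (k + 1)| ≤ √(2 * Dform L A n f) := by
    intro k hk
    obtain ⟨w, hw⟩ := bottom_word L A h n k hk
    apply Real.abs_le_sqrt
    have e0 : (((k : ℝ) / (L : ℝ) ^ n, 0) : ℝ × ℝ) = PsiW L w (0, 0) := by
      rw [hw]; simp
    have e1 : ((((k + 1 : ℕ) : ℝ) / (L : ℝ) ^ n, 0) : ℝ × ℝ) = PsiW L w (1, 0) := by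
      rw [hw]; push_cast; rw [add_comm]
    simp only [hg]
    rw [e0, e1]
    exact edge_le L A n f _ _ (mem_VN_of _ _ _ _ _ v0) (mem_VN_of _ _ _ _ _ v1)
      ⟨w, _, v0, _, v1, by simp [eudist], rfl, rfl⟩
  have hg0 : g 0 = 1 := by
    obtain ⟨w, hw⟩ := bottom_word L A h n 0 hN
    apply h1
    refine ⟨?_, by simp⟩
    have := mem_VN_of L A n w _ v0
    rw [hw] at this
    simpa using this
  have hg1 : g (L ^ n) = 0 := by
    obtain ⟨w, hw⟩ := bottom_word L A h n (L ^ n - 1) (by omega)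
    apply h0
    have e : (((L ^ n : ℕ) : ℝ) / (L : ℝ) ^ n) = 1 := by
      push_cast; exact div_self hL'.ne'
    rw [e]
    refine ⟨?_, by simp⟩
    have := mem_VN_of L A n w _ v1
    rw [hw, Nat.cast_sub hN] at this
    have e2 : (1 + (((L ^ n : ℕ) : ℝ) - ((1 : ℕ) : ℝ))) / (L : ℝ) ^ n = 1 := by
      rw [Nat.cast_one, add_sub_cancel]; exact e
    rw [Nat.succ_eq_add_one, zero_add, e2] at this
    exact this
  have htel : ∑ k ∈ Finset.range (L ^ n), (g k - g (k + 1)) = 1 := by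
    rw [Finset.sum_range_sub', hg0, hg1]; simp
  have hle : (1 : ℝ) ≤ (L : ℝ) ^ n * √(2 * Dform L A n f) := by
    calc (1 : ℝ) = ∑ k ∈ Finset.range (L ^ n), (g k - g (k + 1)) := htel.symm
      _ ≤ ∑ k ∈ Finset.range (L ^ n), √(2 * Dform L A n f) :=
        Finset.sum_le_sum fun k hk => (le_abs_self _).trans (hstep k (Finset.mem_range.1 hk))
      _ = _ := by simp
  have hD := Dform_nonneg L A n f
  have hsq : (1 : ℝ) ≤ ((L : ℝ) ^ n) ^ 2 * (2 * Dform L A n f) := by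
    have := pow_le_pow_left₀ zero_le_one hle 2
    rw [mul_pow, Real.sq_sqrt (by positivity)] at this
    simpa using this
  rw [inv_le_iff_one_le_mul₀ (by positivity)]
  linarith

theorem Dform_upper (L : ℕ) (A : Finset (ℕ × ℕ)) (h : GoodCarpet L A) (n : ℕ) :
    Dform L A n (fun x => 1 - x.1) ≤ 8 * ((A.card : ℝ) / (L : ℝ) ^ 2) ^ n := by
  have hL0 : 0 < L := by have := h.three_le; omega
  have hL' : (0 : ℝ) < (L : ℝ) ^ n := by positivity
  have hbd : ∀ x y, Adj L A n x y → ((1 - x.1) - (1 - y.1)) ^ 2 ≤ (((L : ℝ) ^ n) ^ 2)⁻¹ := by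
    rintro x y ⟨w, p, hp, q, hq, -, rfl, rfl⟩
    obtain ⟨s, hs⟩ := PsiW_form L hL0 w
    rw [hs, hs]
    have e : (1 - (p.1 + s) / (L : ℝ) ^ n - (1 - (q.1 + s) / (L : ℝ) ^ n)) ^ 2
        = (q.1 - p.1) ^ 2 * (((L : ℝ) ^ n) ^ 2)⁻¹ := by
      field_simp
      ring
    rw [e]
    have : (q.1 - p.1) ^ 2 ≤ 1 := by
      simp only [V0, Finset.mem_insert, Finset.mem_singleton] at hp hq
      rcases hp with rfl | rfl | rfl | rfl <;> rcases hq with rfl | rfl | rfl | rfl <;> norm_num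
    exact mul_le_of_le_one_left (by positivity) this
  have hcard : (((VN L A n ×ˢ VN L A n).filter fun z => Adj L A n z.1 z.2).card) ≤
      A.card ^ n * 16 := by
    have hsub : ((VN L A n ×ˢ VN L A n).filter fun z => Adj L A n z.1 z.2) ⊆
        ((Finset.univ : Finset (Word A n)) ×ˢ (V0 ×ˢ V0)).image
          (fun z => (PsiW L z.1 z.2.1, PsiW L z.1 z.2.2)) := by
      rintro ⟨x, y⟩ hz
      obtain ⟨w, p, hp, q, hq, -, hx, hy⟩ := (Finset.mem_filter.1 hz).2
      refine Finset.mem_image.2 ⟨(w, p, q), ?_, ?_⟩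
      · simp [hp, hq]
      · simp only [] at hx hy
        rw [hx, hy]
    refine (Finset.card_le_card hsub).trans (Finset.card_image_le.trans ?_)
    have h4 : V0.card ≤ 4 := Finset.card_le_four
    rw [Finset.card_product, Finset.card_product]
    have : (Finset.univ : Finset (Word A n)).card = A.card ^ n := by simp
    rw [this]
    exact Nat.mul_le_mul_left _ (by nlinarith)
  unfold Dform
  rw [← Finset.sum_product', ← Finset.sum_filter]
  have hsum := Finset.sum_le_card_nsmul
    ((VN L A n ×ˢ VN L A n).filter fun z => Adj L A n z.1 z.2)
    (fun z => ((1 - z.1.1) - (1 - z.2.1)) ^ 2) ((((L : ℝ) ^ n) ^ 2)⁻¹)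
    (fun z hz => hbd _ _ (Finset.mem_filter.1 hz).2)
  have hcard' : ((((VN L A n ×ˢ VN L A n).filter fun z => Adj L A n z.1 z.2).card : ℕ) : ℝ) ≤
      (A.card : ℝ) ^ n * 16 := by exact_mod_cast hcard
  rw [nsmul_eq_mul] at hsum
  have h2 := mul_le_mul_of_nonneg_right hcard' (show 0 ≤ (((L : ℝ) ^ n) ^ 2)⁻¹ by positivity)
  have e : 8 * ((A.card : ℝ) / (L : ℝ) ^ 2) ^ n
      = 1 / 2 * ((A.card : ℝ) ^ n * 16 * (((L : ℝ) ^ n) ^ 2)⁻¹) := by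
    rw [div_pow, ← pow_mul, ← pow_mul, mul_comm 2 n]
    ring
  rw [e]
  exact mul_le_mul_of_nonneg_left (hsum.trans h2) (by norm_num)

/-- Lemma 3.5, planar case: a priori exponential lower bound for the
side-to-side resistance `𝓡̄_n`. -/
theorem side_resistance_lower_bound (L : ℕ) (A : Finset (ℕ × ℕ)) (h : GoodCarpet L A) :
    ∃ c : ℝ, 1 ≤ c ∧ 1 < (L : ℝ) ^ 2 / A.card ∧
      ∀ n : ℕ, c⁻¹ * ((L : ℝ) ^ 2 / A.card) ^ n ≤ RRbar L A n := by
  have hL0 : 0 < L := by have := h.three_le; omega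
  have hA : 0 < A.card :=
    Finset.card_pos.2 ⟨(0, 0), h.flat_border 0 0 hL0 hL0 (Or.inl rfl)⟩
  have hlt : A.card < L ^ 2 := by
    obtain ⟨a, b, ha, hb, hab⟩ := h.proper
    have hss : A ⊂ Finset.range L ×ˢ Finset.range L := by
      refine (Finset.ssubset_iff_of_subset ?_).2 ⟨(a, b), by simp [ha, hb], hab⟩
      intro p hp
      have := h.mem_lt p hp
      simp [Finset.mem_product, this]
    have := Finset.card_lt_card hss
    simpa [sq] using this
  have hA' : (0 : ℝ) < A.card := by exact_mod_cast hA
  refine ⟨8, by norm_num, ?_, fun n => ?_⟩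
  · rw [one_lt_div hA']
    exact_mod_cast hlt
  unfold RRbar EffRes
  set S := {e : ℝ | ∃ f : ℝ × ℝ → ℝ,
      (∀ x ∈ (VN L A n : Set (ℝ × ℝ)) ∩ ({(0 : ℝ)} ×ˢ Set.Icc (0 : ℝ) 1), f x = 1) ∧
      (∀ x ∈ (VN L A n : Set (ℝ × ℝ)) ∩ ({(1 : ℝ)} ×ˢ Set.Icc (0 : ℝ) 1), f x = 0) ∧
      e = Dform L A n f} with hS
  have hmem : Dform L A n (fun x => 1 - x.1) ∈ S := by
    refine ⟨_, ?_, ?_, rfl⟩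
    · rintro x ⟨-, hx, -⟩
      have : x.1 = 0 := hx
      simp [this]
    · rintro x ⟨-, hx, -⟩
      have : x.1 = 1 := hx
      simp [this]
  have hlow : ∀ e ∈ S, (2 * ((L : ℝ) ^ n) ^ 2)⁻¹ ≤ e := by
    rintro e ⟨f, h1, h0, rfl⟩
    exact Dform_lower L A h n f h1 h0
  have hpos : 0 < sInf S :=
    lt_of_lt_of_le (by positivity) (le_csInf ⟨_, hmem⟩ hlow)
  have hup : sInf S ≤ 8 * ((A.card : ℝ) / (L : ℝ) ^ 2) ^ n :=
    (csInf_le ⟨_, fun e he => hlow e he⟩ hmem).trans (Dform_upper L A h n)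
  have e : (8 : ℝ)⁻¹ * ((L : ℝ) ^ 2 / A.card) ^ n
      = (8 * ((A.card : ℝ) / (L : ℝ) ^ 2) ^ n)⁻¹ := by
    rw [mul_inv, ← inv_pow, inv_div]
  rw [e]
  exact inv_anti₀ hpos hup


end Carpet
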